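/- If the curve evolves by Airy flow, X_t = (−k_s) n + (k²/2) τ, then its curvature satisfies the modified Korteweg–de Vries equation k_t = k_sss + (3/2) k² k_s, where arclength derivatives are f_s = f_α/s_α applied repeatedly. -/

import Mathlib

open scoped Real

/-- Partial derivative with respect to the spatial parameter `α`. -/
noncomputable def pderA (f : ℝ → ℝ → ℝ) (α t : ℝ) : ℝ := deriv (fun a => f a t) α

/-- Partial derivative with respect to time `t`. -/
noncomputable def pderT (f : ℝ → ℝ → ℝ) (α t : ℝ) : ℝ := deriv (fun τ => f α τ) t

/-- Arclength element `s_α = √(x_α² + y_α²)`. -/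
noncomputable def sA (x y : ℝ → ℝ → ℝ) (α t : ℝ) : ℝ :=
  Real.sqrt (pderA x α t ^ 2 + pderA y α t ^ 2)

/-- Arclength derivative `f_s = f_α / s_α`. -/
noncomputable def arcD (x y f : ℝ → ℝ → ℝ) (α t : ℝ) : ℝ :=
  pderA f α t / sA x y α t

theorem pderA_eq_fderiv {f : ℝ → ℝ → ℝ} (hf : ContDiff ℝ (⊤ : ℕ∞) (Function.uncurry f)) (α t : ℝ) :
    HasDerivAt (fun a => f a t) (fderiv ℝ (Function.uncurry f) (α, t) (1, 0)) α := by
  have h1 := (hf.differentiable (by simp) (α, t)).hasFDerivAt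
  have h2 : HasDerivAt (fun a : ℝ => (a, t)) ((1 : ℝ), (0 : ℝ)) α :=
    (hasDerivAt_id α).prodMk (hasDerivAt_const α t)
  exact h1.comp_hasDerivAt α h2

theorem pderT_eq_fderiv {f : ℝ → ℝ → ℝ} (hf : ContDiff ℝ (⊤ : ℕ∞) (Function.uncurry f)) (α t : ℝ) :
    HasDerivAt (fun b => f α b) (fderiv ℝ (Function.uncurry f) (α, t) (0, 1)) t := by
  have h1 := (hf.differentiable (by simp) (α, t)).hasFDerivAt
  have h2 : HasDerivAt (fun b : ℝ => (α, b)) ((0 : ℝ), (1 : ℝ)) t :=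
    (hasDerivAt_const t α).prodMk (hasDerivAt_id t)
  exact h1.comp_hasDerivAt t h2

theorem hasA {f : ℝ → ℝ → ℝ} (hf : ContDiff ℝ (⊤ : ℕ∞) (Function.uncurry f)) (α t : ℝ) :
    HasDerivAt (fun a => f a t) (pderA f α t) α :=
  (pderA_eq_fderiv hf α t).differentiableAt.hasDerivAt

theorem hasT {f : ℝ → ℝ → ℝ} (hf : ContDiff ℝ (⊤ : ℕ∞) (Function.uncurry f)) (α t : ℝ) :
    HasDerivAt (fun b => f α b) (pderT f α t) t :=
  (pderT_eq_fderiv hf α t).differentiableAt.hasDerivAt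

theorem uncurry_pderA {f : ℝ → ℝ → ℝ} (hf : ContDiff ℝ (⊤ : ℕ∞) (Function.uncurry f)) :
    Function.uncurry (pderA f) = fun p => fderiv ℝ (Function.uncurry f) p (1, 0) := by
  funext ⟨a, b⟩
  exact (pderA_eq_fderiv hf a b).deriv

theorem uncurry_pderT {f : ℝ → ℝ → ℝ} (hf : ContDiff ℝ (⊤ : ℕ∞) (Function.uncurry f)) :
    Function.uncurry (pderT f) = fun p => fderiv ℝ (Function.uncurry f) p (0, 1) := by
  funext ⟨a, b⟩
  exact (pderT_eq_fderiv hf a b).deriv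

theorem smA {f : ℝ → ℝ → ℝ} (hf : ContDiff ℝ (⊤ : ℕ∞) (Function.uncurry f)) :
    ContDiff ℝ (⊤ : ℕ∞) (Function.uncurry (pderA f)) := by
  rw [uncurry_pderA hf]
  exact (hf.fderiv_right (m := (⊤ : ℕ∞)) (by simp)).clm_apply contDiff_const

theorem smT {f : ℝ → ℝ → ℝ} (hf : ContDiff ℝ (⊤ : ℕ∞) (Function.uncurry f)) :
    ContDiff ℝ (⊤ : ℕ∞) (Function.uncurry (pderT f)) := by
  rw [uncurry_pderT hf]
  exact (hf.fderiv_right (m := (⊤ : ℕ∞)) (by simp)).clm_apply contDiff_const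

theorem pder_comm {f : ℝ → ℝ → ℝ} (hf : ContDiff ℝ (⊤ : ℕ∞) (Function.uncurry f)) (α t : ℝ) :
    pderT (pderA f) α t = pderA (pderT f) α t := by
  have h1 : pderT (pderA f) α t = _ := (pderT_eq_fderiv (smA hf) α t).deriv
  have h2 : pderA (pderT f) α t = _ := (pderA_eq_fderiv (smT hf) α t).deriv
  have hd : DifferentiableAt ℝ (fderiv ℝ (Function.uncurry f)) (α, t) :=
    (hf.fderiv_right (m := (⊤ : ℕ∞)) (by simp)).differentiable (by simp) (α, t)
  have hs : IsSymmSndFDerivAt ℝ (Function.uncurry f) (α, t) :=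
    hf.contDiffAt.isSymmSndFDerivAt (by
      simp only [minSmoothness_of_isRCLikeNormedField]
      exact WithTop.coe_le_coe.2 le_top)
  rw [h1, h2, uncurry_pderA hf, uncurry_pderT hf,
    fderiv_clm_apply hd (differentiableAt_const _), fderiv_clm_apply hd (differentiableAt_const _)]
  simpa using hs.eq (0, 1) (1, 0)

theorem sm_arcD {x y f : ℝ → ℝ → ℝ} (hS : ContDiff ℝ (⊤ : ℕ∞) (Function.uncurry (sA x y)))
    (hpos : ∀ α t, 0 < sA x y α t) (hf : ContDiff ℝ (⊤ : ℕ∞) (Function.uncurry f)) :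
    ContDiff ℝ (⊤ : ℕ∞) (Function.uncurry (arcD x y f)) :=
  (smA hf).div hS (fun p => (hpos p.1 p.2).ne')

/-- If the curve evolves by Airy flow
`X_t = (−k_s) n + (k²/2) τ`, where `k = θ_α/s_α` and `k_s = k_α/s_α`, then its
curvature satisfies the mKdV equation `k_t = k_sss + (3/2) k² k_s`. -/
theorem airy_flow_curvature_mkdv
    (x y θ : ℝ → ℝ → ℝ)
    (hx : ContDiff ℝ (⊤ : ℕ∞) (Function.uncurry x))
    (hy : ContDiff ℝ (⊤ : ℕ∞) (Function.uncurry y))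
    (hθ : ContDiff ℝ (⊤ : ℕ∞) (Function.uncurry θ))
    (hperx : ∀ α t, x (α + 2 * π) t = x α t)
    (hpery : ∀ α t, y (α + 2 * π) t = y α t)
    (hpos : ∀ α t, 0 < sA x y α t)
    (htanx : ∀ α t, pderA x α t = sA x y α t * Real.cos (θ α t))
    (htany : ∀ α t, pderA y α t = sA x y α t * Real.sin (θ α t))
    (hevolx : ∀ α t, pderT x α t =
      (-(arcD x y (arcD x y θ) α t)) * Real.sin (θ α t)
        + ((arcD x y θ α t) ^ 2 / 2) * Real.cos (θ α t))
    (hevoly : ∀ α t, pderT y α t =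
      -(-(arcD x y (arcD x y θ) α t)) * Real.cos (θ α t)
        + ((arcD x y θ α t) ^ 2 / 2) * Real.sin (θ α t)) :
    ∀ α t, pderT (arcD x y θ) α t =
      arcD x y (arcD x y (arcD x y (arcD x y θ))) α t
        + (3 / 2) * (arcD x y θ α t) ^ 2 * arcD x y (arcD x y θ) α t := by
  have hS : ContDiff ℝ (⊤ : ℕ∞) (Function.uncurry (sA x y)) := by
    refine ContDiff.sqrt (f := fun p : ℝ × ℝ => Function.uncurry (pderA x) p ^ 2
      + Function.uncurry (pderA y) p ^ 2) (((smA hx).pow 2).add ((smA hy).pow 2)) ?_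
    intro p
    exact (Real.sqrt_pos.mp (hpos p.1 p.2)).ne'
  have hA : ∀ f : ℝ → ℝ → ℝ, ∀ α t, pderA f α t = sA x y α t * arcD x y f α t := by
    intro f α t
    have := (hpos α t).ne'
    unfold arcD
    field_simp
  have hK := sm_arcD hS hpos hθ
  have hK1 := sm_arcD hS hpos hK
  have hK2 := sm_arcD hS hpos hK1
  have key : ∀ α t, pderT (sA x y) α t = 0 ∧
      pderT θ α t = arcD x y (arcD x y (arcD x y θ)) α t + (arcD x y θ α t) ^ 3 / 2 := by
    intro α t
    have ex : pderA x = fun α t => sA x y α t * Real.cos (θ α t) := by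
      funext a b; exact htanx a b
    have ey : pderA y = fun α t => sA x y α t * Real.sin (θ α t) := by
      funext a b; exact htany a b
    have fx := funext fun a => funext fun b => hevolx a b
    have fy := funext fun a => funext fun b => hevoly a b
    have cx := pder_comm hx α t
    have cy := pder_comm hy α t
    rw [ex, show pderT x = _ from fx] at cx
    rw [ey, show pderT y = _ from fy] at cy
    have l1 := ((hasT hS α t).mul (hasT hθ α t).cos).deriv
    have l2 := ((hasT hS α t).mul (hasT hθ α t).sin).deriv
    have r1 := (((hasA hK1 α t).neg.mul (hasA hθ α t).sin).add
      ((((hasA hK α t).pow 2).div_const 2).mul (hasA hθ α t).cos)).deriv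
    have r2 := (((hasA hK1 α t).neg.neg.mul (hasA hθ α t).cos).add
      ((((hasA hK α t).pow 2).div_const 2).mul (hasA hθ α t).sin)).deriv
    have ecx := l1.symm.trans (Eq.trans cx r1)
    have ecy := l2.symm.trans (Eq.trans cy r2)
    simp only [hA (arcD x y (arcD x y θ)), hA (arcD x y θ), hA θ, Pi.neg_apply, Pi.pow_apply] at ecx ecy
    have hsc := Real.sin_sq_add_cos_sq (θ α t)
    have hp := (hpos α t).ne'
    norm_num at ecx ecy
    generalize arcD x y (arcD x y (arcD x y θ)) α t = K2 at *
    generalize arcD x y (arcD x y θ) α t = K1 at *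
    generalize arcD x y θ α t = K at *
    generalize sA x y α t = S at *
    generalize pderT (sA x y) α t = St at *
    generalize pderT θ α t = Tt at *
    generalize Real.sin (θ α t) = s at *
    generalize Real.cos (θ α t) = c at *
    constructor
    · linear_combination c * ecx + s * ecy - St * hsc
    · apply mul_left_cancel₀ hp
      linear_combination c * ecy - s * ecx + (S * (K2 + K ^ 3 / 2) - S * Tt) * hsc
  intro α t
  have hp := (hpos α t).ne'
  have e1 : pderT θ = fun α t => arcD x y (arcD x y (arcD x y θ)) α t + (arcD x y θ α t) ^ 3 / 2 := by
    funext a b; exact (key a b).2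
  have c := pder_comm hθ α t
  rw [e1] at c
  have r := ((hasA hK2 α t).add (((hasA hK α t).pow 3).div_const 2)).deriv
  have l := ((hasT (smA hθ) α t).div (hasT hS α t) hp).deriv
  have c2 := c.trans r
  refine Eq.trans l ?_
  rw [c2, (key α t).1, hA (arcD x y (arcD x y (arcD x y θ))), hA (arcD x y θ)]
  push_cast
  field_simp
  ring
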